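/- arXiv:1306.3623 — 11 statements merged into one kernel-verified Lean document; each statement's English description precedes it below -/
import Mathlib

section
/- Let m0, m1, m, p be positive integers with gcd(m0,m1) = 1, m0·m1 ∣ m and m ∣ p. Define Z(m,p) = {(β,γ) ∈ ZMod p × ZMod p : ((m/m1 : ℤ) : ZMod p)·γ = ((m/m0 : ℤ) : ZMod p)·β}. Then Z(m,p) is exactly the set {t·((m0 : ZMod p), (m1 : ZMod p)) + u·(0, ((p/m)·m1 : ZMod p)) : t, u ∈ ℤ}; that is, Z(m,p) is generated as an additive group by the two elements ((m0 : ZMod p), (m1 : ZMod p)) and (0, ((p/m)·m1 : ZMod p)). -/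
/-- For positive integers `m0, m1, m, p` with `gcd(m0,m1) = 1`,
`m0·m1 ∣ m` and `m ∣ p`, the group
`Z(m,p) = {(β,γ) ∈ ZMod p × ZMod p : (m/m1)·γ = (m/m0)·β}` is exactly the set of
integer combinations of `((m0 : ZMod p), (m1 : ZMod p))` and
`(0, ((p/m)·m1 : ZMod p))`. -/
theorem stmt_1 (m0 m1 m p : ℕ) (hm0 : 0 < m0) (hm1 : 0 < m1) (hm : 0 < m) (hp : 0 < p)
    (hcop : Nat.gcd m0 m1 = 1) (hdm : m0 * m1 ∣ m) (hmp : m ∣ p) :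
    {z : ZMod p × ZMod p | ((m / m1 : ℕ) : ZMod p) * z.2 = ((m / m0 : ℕ) : ZMod p) * z.1} =
      {z : ZMod p × ZMod p | ∃ t u : ℤ,
        z = t • ((m0 : ZMod p), (m1 : ZMod p)) +
            u • ((0 : ZMod p), ((p / m * m1 : ℕ) : ZMod p))} := by
  obtain ⟨k, rfl⟩ := hdm
  obtain ⟨l, rfl⟩ := hmp
  have hk : 0 < k := Nat.pos_of_mul_pos_left hm
  have h1 : m0 * m1 * k / m1 = m0 * k :=
    Nat.div_eq_of_eq_mul_left hm1 (by ring)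
  have h0 : m0 * m1 * k / m0 = m1 * k :=
    Nat.div_eq_of_eq_mul_left hm0 (by ring)
  have hl : m0 * m1 * k * l / (m0 * m1 * k) = l := Nat.mul_div_cancel_left l hm
  rw [h1, h0, hl]
  have hzero : ((m0 * m1 * k * l : ℕ) : ZMod (m0 * m1 * k * l)) = 0 := ZMod.natCast_self _
  push_cast at hzero
  ext ⟨x, y⟩
  simp only [Set.mem_ofPred_eq, Prod.smul_mk, Prod.mk_add_mk, Prod.mk.injEq, zsmul_eq_mul,
    mul_zero, add_zero]
  constructor
  · intro h
    obtain ⟨b, rfl⟩ := ZMod.intCast_surjective x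
    obtain ⟨c, rfl⟩ := ZMod.intCast_surjective y
    have hdvd : ((m0 * m1 * k * l : ℕ) : ℤ) ∣ m0 * k * c - m1 * k * b := by
      rw [← ZMod.intCast_zmod_eq_zero_iff_dvd]
      push_cast at h ⊢
      rw [h, sub_self]
    obtain ⟨s, hs⟩ := hdvd
    push_cast at hs
    have hkz : (k : ℤ) ≠ 0 := by exact_mod_cast hk.ne'
    have hm0z : (m0 : ℤ) ≠ 0 := by exact_mod_cast hm0.ne'
    have hs' : (m0 : ℤ) * c - m1 * b = m0 * m1 * l * s :=
      mul_left_cancel₀ hkz (by linear_combination hs)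
    have hb : (m0 : ℤ) ∣ b :=
      (Nat.isCoprime_iff_coprime.mpr hcop).dvd_of_dvd_mul_left
        ⟨c - m1 * l * s, by linear_combination -hs'⟩
    obtain ⟨t, rfl⟩ := hb
    have hc : c = m1 * t + l * m1 * s :=
      mul_left_cancel₀ hm0z (by linear_combination hs')
    refine ⟨t, s, ?_, ?_⟩
    · push_cast
      ring
    · rw [hc]
      push_cast
      ring
  · rintro ⟨t, u, rfl, rfl⟩
    push_cast
    linear_combination (u : ZMod (m0 * m1 * k * l)) * hzero
end

section
/- Let m0, m1, m, p be positive integers with gcd(m0,m1) = 1, m0·m1 ∣ m and m ∣ p. For every (a, β, γ) ∈ ℤ × ZMod p × ZMod p with (β, γ) ∈ Z(m,p), there exist integers c1, c2, c3 such that (a, β, γ) = c1·(1, 0, 0) + c2·(1, (m0 : ZMod p), (m1 : ZMod p)) + c3·(p/m, 0, ((p/m)·m1 : ZMod p)) in ℤ × ZMod p × ZMod p. -/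
/-- For positive integers `m0, m1, m, p` with `gcd(m0,m1) = 1`,
`m0·m1 ∣ m` and `m ∣ p`, every `(a, β, γ) ∈ ℤ × ZMod p × ZMod p` with
`(β, γ) ∈ Z(m,p)` is an integer combination of the three elements
`(1, 0, 0)`, `(1, m̄0, m̄1)` and `(p/m, 0, (p/m)·m̄1)`
(the classes `[δ0]`, `[δ1]` and `[id]`). -/
theorem stmt_2 (m0 m1 m p : ℕ) (hm0 : 0 < m0) (hm1 : 0 < m1) (hm : 0 < m) (hp : 0 < p)
    (hcop : Nat.gcd m0 m1 = 1) (hdm : m0 * m1 ∣ m) (hmp : m ∣ p)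
    (a : ℤ) (β γ : ZMod p)
    (hZ : ((m / m1 : ℕ) : ZMod p) * γ = ((m / m0 : ℕ) : ZMod p) * β) :
    ∃ c1 c2 c3 : ℤ,
      ((a, β, γ) : ℤ × ZMod p × ZMod p) =
        c1 • ((1 : ℤ), (0 : ZMod p), (0 : ZMod p)) +
        c2 • ((1 : ℤ), (m0 : ZMod p), (m1 : ZMod p)) +
        c3 • (((p / m : ℕ) : ℤ), (0 : ZMod p), ((p / m * m1 : ℕ) : ZMod p)) := by
  obtain ⟨k, rfl⟩ := hdm
  obtain ⟨q, rfl⟩ := hmp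
  have hk : 0 < k := Nat.pos_of_mul_pos_left hm
  have h1 : m0 * m1 * k / m1 = m0 * k := Nat.div_eq_of_eq_mul_left hm1 (by ring)
  have h0 : m0 * m1 * k / m0 = m1 * k := Nat.div_eq_of_eq_mul_left hm0 (by ring)
  have hq : m0 * m1 * k * q / (m0 * m1 * k) = q := Nat.mul_div_cancel_left q hm
  rw [h1, h0] at hZ
  rw [hq]
  obtain ⟨x, rfl⟩ := ZMod.intCast_surjective β
  obtain ⟨y, rfl⟩ := ZMod.intCast_surjective γ
  have hdvd : ((m0 * m1 * k * q : ℕ) : ℤ) ∣ m0 * k * y - m1 * k * x := by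
    rw [← ZMod.intCast_zmod_eq_zero_iff_dvd]
    push_cast at hZ ⊢
    rw [hZ, sub_self]
  obtain ⟨t, ht⟩ := hdvd
  push_cast at ht
  have hk' : (k : ℤ) ≠ 0 := by exact_mod_cast hk.ne'
  have hm0' : (m0 : ℤ) ≠ 0 := by exact_mod_cast hm0.ne'
  have hrel : (m0 : ℤ) * y - m1 * x = m0 * m1 * q * t :=
    mul_left_cancel₀ hk' (by linear_combination ht)
  have hcop' : IsCoprime (m0 : ℤ) (m1 : ℤ) := Nat.isCoprime_iff_coprime.mpr hcop
  obtain ⟨b, rfl⟩ : (m0 : ℤ) ∣ x :=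
    hcop'.dvd_of_dvd_mul_left ⟨y - m1 * q * t, by linear_combination -hrel⟩
  have hy : y = b * m1 + t * (q * m1) :=
    mul_left_cancel₀ hm0' (by linear_combination hrel)
  refine ⟨a - b - t * q, b, t, ?_⟩
  subst hy
  ext
  · simp only [Prod.smul_mk, Prod.mk_add_mk, smul_eq_mul]
    ring
  · simp [mul_comm]
  · simp
end

section
/- Let m0, m1, m, p be positive integers with gcd(m0,m1) = 1, m0·m1 ∣ m and m ∣ p. Suppose (a, β, γ) ∈ ℤ × ZMod p × ZMod p satisfies: (β, γ) ∈ Z(m,p), and there exist natural numbers b, c with (b : ZMod p) = β, (c : ZMod p) = γ, b ≤ a·m0 and c ≤ a·m1. Then there exist natural numbers c1, c2, c3, c4 such that (a, β, γ) = c1·(1, 0, 0) + c2·(1, (m0 : ZMod p), (m1 : ZMod p)) + c3·(p/m, 0, ((p/m)·m1 : ZMod p)) + c4·(p/m, ((p/m)·m0 : ZMod p), 0). -/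
/-- If `m0 * m1 * k` divides `m1 * b - m0 * c` with `m0, m1` coprime, then `b` and `c` are
multiples of `m0` and `m1` whose cofactors agree modulo `k`. -/
theorem exists_eq_mul_of_mul_dvd_sub {m0 m1 k b c : ℕ} (hm0 : 0 < m0) (hm1 : 0 < m1)
    (hcop : Nat.Coprime m0 m1) (h : (m0 * m1 * k : ℤ) ∣ m1 * b - m0 * c) :
    ∃ x y : ℕ, b = m0 * x ∧ c = m1 * y ∧ (k : ℤ) ∣ x - y := by
  obtain ⟨z, hz⟩ := h
  have hb : m0 ∣ b := by
    refine hcop.dvd_of_dvd_mul_left (Int.natCast_dvd_natCast.mp ⟨c + m1 * k * z, ?_⟩)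
    push_cast
    linear_combination hz
  have hc : m1 ∣ c := by
    refine hcop.symm.dvd_of_dvd_mul_left (Int.natCast_dvd_natCast.mp ⟨b - m0 * k * z, ?_⟩)
    push_cast
    linear_combination -hz
  obtain ⟨x, rfl⟩ := hb
  obtain ⟨y, rfl⟩ := hc
  refine ⟨x, y, rfl, rfl, z, ?_⟩
  have hne : (m0 * m1 : ℤ) ≠ 0 := by positivity
  apply mul_left_cancel₀ hne
  push_cast at hz
  linear_combination hz


/-- (Lemma 3.3) For positive integers `m0, m1, m, p` with
`gcd(m0,m1) = 1`, `m0·m1 ∣ m` and `m ∣ p`, every element `(a, β, γ)` of the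
Dadarlat–Loring positive cone of `ℤ × Z(m,p)` (i.e. `(β,γ) ∈ Z(m,p)` and `β, γ`
admit natural-number representatives `b ≤ a·m0`, `c ≤ a·m1`) is a nonnegative
integer combination of the four classes `[δ0]`, `[δ1]`, `[id]`, `[id‾]`. -/
theorem stmt_3 (m0 m1 m p : ℕ) (hm0 : 0 < m0) (hm1 : 0 < m1) (hm : 0 < m) (hp : 0 < p)
    (hcop : Nat.gcd m0 m1 = 1) (hdm : m0 * m1 ∣ m) (hmp : m ∣ p)
    (a : ℤ) (β γ : ZMod p)
    (hZ : ((m / m1 : ℕ) : ZMod p) * γ = ((m / m0 : ℕ) : ZMod p) * β)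
    (hpos : ∃ b c : ℕ, (b : ZMod p) = β ∧ (c : ZMod p) = γ ∧
      (b : ℤ) ≤ a * m0 ∧ (c : ℤ) ≤ a * m1) :
    ∃ c1 c2 c3 c4 : ℕ,
      ((a, β, γ) : ℤ × ZMod p × ZMod p) =
        c1 • ((1 : ℤ), (0 : ZMod p), (0 : ZMod p)) +
        c2 • ((1 : ℤ), (m0 : ZMod p), (m1 : ZMod p)) +
        c3 • (((p / m : ℕ) : ℤ), (0 : ZMod p), ((p / m * m1 : ℕ) : ZMod p)) +
        c4 • (((p / m : ℕ) : ℤ), ((p / m * m0 : ℕ) : ZMod p), (0 : ZMod p)) := by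
  obtain ⟨b, c, rfl, rfl, hb, hc⟩ := hpos
  obtain ⟨d, rfl⟩ := hdm
  obtain ⟨k, rfl⟩ := hmp
  have hd : 0 < d := Nat.pos_of_mul_pos_left hm
  rw [Nat.mul_div_cancel_left k hm]
  rw [show m0 * m1 * d / m1 = m0 * d from Nat.div_eq_of_eq_mul_left hm1 (by ring),
    show m0 * m1 * d / m0 = m1 * d from Nat.div_eq_of_eq_mul_left hm0 (by ring)] at hZ
  have hdvd : (m0 * m1 * k : ℤ) ∣ m1 * b - m0 * c := by
    have hmod : m0 * d * c ≡ m1 * d * b [MOD m0 * m1 * d * k] := by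
      rw [← ZMod.natCast_eq_natCast_iff]
      exact_mod_cast hZ
    obtain ⟨z, hz⟩ := hmod.dvd
    refine ⟨z, mul_left_cancel₀ (show (d : ℤ) ≠ 0 by positivity) ?_⟩
    push_cast at hz
    linear_combination hz
  obtain ⟨x, y, rfl, rfl, hxy⟩ := exists_eq_mul_of_mul_dvd_sub hm0 hm1 hcop hdvd
  have hxa : (x : ℤ) ≤ a :=
    le_of_mul_le_mul_left (by push_cast at hb; linarith) (show (0 : ℤ) < m0 by positivity)
  have hya : (y : ℤ) ≤ a :=
    le_of_mul_le_mul_left (by push_cast at hc; linarith) (show (0 : ℤ) < m1 by positivity)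
  lift a to ℕ using (Int.natCast_nonneg x).trans hxa
  obtain ⟨u, hu⟩ := Nat.exists_eq_add_of_le (Int.ofNat_le.mp hxa)
  obtain ⟨v, hv⟩ := Nat.exists_eq_add_of_le (Int.ofNat_le.mp hya)
  rcases le_total x y with h | h
  · obtain ⟨t, ht⟩ : k ∣ y - x := by
      rw [← Int.natCast_dvd_natCast, Nat.cast_sub h]
      exact (dvd_sub_comm).mp hxy
    obtain rfl : y = x + k * t := by omega
    refine ⟨v, x, t, 0, ?_⟩
    ext <;> simp [hv] <;> ring
  · obtain ⟨t, ht⟩ : k ∣ x - y := by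
      rwa [← Int.natCast_dvd_natCast, Nat.cast_sub h]
    obtain rfl : x = y + k * t := by omega
    refine ⟨u, y, 0, t, ?_⟩
    ext <;> simp [hu] <;> ring
end

section
/- Let m0, m1, m, n, p be positive integers with gcd(m0,m1) = 1, m0·m1 ∣ m, m0·m1 ∣ n and m ∣ p. Let φ be an additive map from the subgroup Z(m,p) of ZMod p × ZMod p to the subgroup Z(n,p) such that: (i) φ((m0 : ZMod p), (m1 : ZMod p)) = 0, and (ii) for every (β,γ) ∈ Z(m,p) and every pair of integers b', c' with ((b' : ZMod p), (c' : ZMod p)) = φ(β,γ), one has p·(n/(m0·m1)) ∣ (n/m1)·c' − (n/m0)·b'. Then there exists an integer d with 0 ≤ d < m/(m0·m1) such that for every (β,γ) ∈ Z(m,p), φ(β,γ) = (d·m0·(m0·γ − m1·β), d·m1·(m0·γ − m1·β)) (all integer coefficients cast into ZMod p). -/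
/-- The subgroup `Z(m,p) = {(β,γ) ∈ ZMod p × ZMod p : (m/m1)·γ = (m/m0)·β}`, modelling
the coefficient K-group `K0(I[m0,m,m1]; ℤ/p)`. -/
def Zgrp (m0 m1 m p : ℕ) : AddSubgroup (ZMod p × ZMod p) where
  carrier := {z | ((m / m1 : ℕ) : ZMod p) * z.2 = ((m / m0 : ℕ) : ZMod p) * z.1}
  zero_mem' := by simp
  add_mem' := by
    intro a b ha hb
    simp only [Set.mem_setOf_eq, Prod.fst_add, Prod.snd_add, mul_add] at *
    rw [ha, hb]
  neg_mem' := by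
    intro a ha
    simp only [Set.mem_setOf_eq, Prod.fst_neg, Prod.snd_neg, mul_neg] at *
    rw [ha]

/-- The pair `(m̄0, m̄1)` (the image of the Bockstein map `μ`) belongs to `Z(m,p)`. -/
lemma mem_Zgrp_pair (m0 m1 m p : ℕ) (hdm : m0 * m1 ∣ m) :
    ((m0 : ZMod p), (m1 : ZMod p)) ∈ Zgrp m0 m1 m p := by
  show ((m / m1 : ℕ) : ZMod p) * (m1 : ZMod p) = ((m / m0 : ℕ) : ZMod p) * (m0 : ZMod p)
  have h1 : m1 ∣ m := (dvd_mul_left m1 m0).trans hdm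
  have h0 : m0 ∣ m := (dvd_mul_right m0 m1).trans hdm
  rw [← Nat.cast_mul, ← Nat.cast_mul, Nat.div_mul_cancel h1, Nat.div_mul_cancel h0]

lemma Nat.mul_mul_div_cancel_left (a b k : ℕ) (ha : 0 < a) : a * b * k / a = b * k := by
  rw [mul_assoc, Nat.mul_div_cancel_left _ ha]

lemma mem_Zgrp_mul_iff {m0 m1 k p : ℕ} (hm0 : 0 < m0) (hm1 : 0 < m1)
    (z : ZMod p × ZMod p) :
    z ∈ Zgrp m0 m1 (m0 * m1 * k) p ↔ (k : ZMod p) * ((m0 : ZMod p) * z.2 - (m1 : ZMod p) * z.1) = 0 := by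
  change ((m0 * m1 * k / m1 : ℕ) : ZMod p) * z.2 = ((m0 * m1 * k / m0 : ℕ) : ZMod p) * z.1 ↔ _
  rw [Nat.mul_mul_div_cancel_left m0 m1 k hm0, mul_comm m0 m1, Nat.mul_mul_div_cancel_left m1 m0 k hm1,
    ← sub_eq_zero]
  push_cast
  ring_nf

lemma ZMod.exists_eq_intCast_mul_of_mul_eq_zero {k q : ℕ} (hk : 0 < k) {x : ZMod (k * q)}
    (hx : (k : ZMod (k * q)) * x = 0) : ∃ j : ℤ, x = j * q := by
  obtain ⟨y, rfl⟩ := ZMod.intCast_surjective x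
  have h : (((k : ℤ) * y : ℤ) : ZMod (k * q)) = 0 := by exact_mod_cast hx
  rw [ZMod.intCast_zmod_eq_zero_iff_dvd, Nat.cast_mul] at h
  obtain ⟨j, rfl⟩ := Int.dvd_of_mul_dvd_mul_left (by exact_mod_cast hk.ne') h
  exact ⟨j, by push_cast; ring⟩

/-- (Lemma 4.1) Let `m0, m1, m, n, p` be positive with `gcd(m0,m1)=1`,
`m0·m1 ∣ m`, `m0·m1 ∣ n`, `m ∣ p`.  Any additive map `φ : Z(m,p) → Z(n,p)` which
(i) kills `(m̄0, m̄1)` (vanishing K₀-multiplicity) and (ii) composes to zero with the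
Bockstein map `ν` of `I[m0,n,m1]` (vanishing K₁-multiplicity) is given by the matrix
`d·[[−m1m0, m0m0], [−m1m1, m0m1]]` for some `0 ≤ d < m/(m0·m1)`. -/
theorem stmt_6 (m0 m1 m n p : ℕ) (hm0 : 0 < m0) (hm1 : 0 < m1) (hm : 0 < m)
    (hn : 0 < n) (hp : 0 < p)
    (hcop : Nat.gcd m0 m1 = 1) (hdm : m0 * m1 ∣ m) (hdn : m0 * m1 ∣ n) (hmp : m ∣ p)
    (φ : Zgrp m0 m1 m p →+ Zgrp m0 m1 n p)
    (hmu : φ ⟨((m0 : ZMod p), (m1 : ZMod p)), mem_Zgrp_pair m0 m1 m p hdm⟩ = 0)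
    (hnu : ∀ z : Zgrp m0 m1 m p, ∀ b' c' : ℤ,
      (b' : ZMod p) = (φ z : ZMod p × ZMod p).1 →
      (c' : ZMod p) = (φ z : ZMod p × ZMod p).2 →
      ((p * (n / (m0 * m1)) : ℕ) : ℤ) ∣
        ((n / m1 : ℕ) : ℤ) * c' - ((n / m0 : ℕ) : ℤ) * b') :
    ∃ d : ℤ, 0 ≤ d ∧ d < ((m / (m0 * m1) : ℕ) : ℤ) ∧
      ∀ z : Zgrp m0 m1 m p,
        (φ z : ZMod p × ZMod p) =
          (((d * m0 : ℤ) : ZMod p) *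
             ((m0 : ZMod p) * (z : ZMod p × ZMod p).2 - (m1 : ZMod p) * (z : ZMod p × ZMod p).1),
           ((d * m1 : ℤ) : ZMod p) *
             ((m0 : ZMod p) * (z : ZMod p × ZMod p).2 - (m1 : ZMod p) * (z : ZMod p × ZMod p).1)) := by
  obtain ⟨M, rfl⟩ := hdm
  obtain ⟨N, rfl⟩ := hdn
  obtain ⟨q, rfl⟩ : M ∣ p := (dvd_mul_left M (m0 * m1)).trans hmp
  have hM : 0 < M := Nat.pos_of_mul_pos_left hm
  have hN : 0 < N := Nat.pos_of_mul_pos_left hn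
  have h01 : 0 < m0 * m1 := Nat.mul_pos hm0 hm1
  rw [Nat.mul_div_cancel_left _ h01] at hnu ⊢
  have hMq : (M : ZMod (M * q)) * q = 0 := by
    exact_mod_cast ZMod.natCast_self (M * q)
  obtain ⟨u, v, huv⟩ : ∃ u v : ℤ, (m0 : ℤ) * u + m1 * v = 1 :=
    ⟨_, _, by rw [← Nat.gcd_eq_gcd_ab, hcop, Nat.cast_one]⟩
  have huv' : (m0 : ZMod (M * q)) * u + m1 * v = 1 := by
    exact_mod_cast congrArg (Int.cast : ℤ → ZMod (M * q)) huv
  let e : Zgrp m0 m1 (m0 * m1 * M) (M * q) := ⟨_, mem_Zgrp_pair m0 m1 _ (M * q) ⟨M, rfl⟩⟩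
  have he : φ e = 0 := hmu
  let g : Zgrp m0 m1 (m0 * m1 * M) (M * q) := ⟨(-(v * q), u * q), by
    rw [mem_Zgrp_mul_iff hm0 hm1]
    linear_combination ((m0 : ZMod (M * q)) * u + m1 * v) * hMq⟩
  have hMg : M • g = 0 := by
    ext
    · simp only [g, AddSubgroup.coe_nsmul, nsmul_eq_mul, Prod.fst_mul,
        Prod.fst_natCast, ZeroMemClass.coe_zero, Prod.fst_zero]
      linear_combination -(v : ZMod (M * q)) * hMq
    · simp only [g, AddSubgroup.coe_nsmul, nsmul_eq_mul, Prod.snd_mul,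
        Prod.snd_natCast, ZeroMemClass.coe_zero, Prod.snd_zero]
      linear_combination (u : ZMod (M * q)) * hMq
  have hMφ : M • (φ g : ZMod (M * q) × ZMod (M * q)) = 0 := by
    rw [← AddSubgroup.coe_nsmul, ← map_nsmul, hMg, map_zero, ZeroMemClass.coe_zero]
  obtain ⟨b, hb⟩ := ZMod.intCast_surjective (φ g : ZMod (M * q) × ZMod (M * q)).1
  obtain ⟨c, hc⟩ := ZMod.intCast_surjective (φ g : ZMod (M * q) × ZMod (M * q)).2
  have hMb : (M : ZMod (M * q)) * b = 0 := by
    simpa [hb] using congrArg Prod.fst hMφ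
  have hMc : (M : ZMod (M * q)) * c = 0 := by
    simpa [hc] using congrArg Prod.snd hMφ
  have hbc : (m0 : ZMod (M * q)) * c - m1 * b = 0 := by
    have h := hnu g b c hb hc
    rw [Nat.mul_mul_div_cancel_left m0 m1 N hm0, mul_comm m0 m1, Nat.mul_mul_div_cancel_left m1 m0 N hm1] at h
    have h' : ((M * q : ℕ) : ℤ) ∣ m0 * c - m1 * b := by
      refine Int.dvd_of_mul_dvd_mul_left (a := (N : ℤ)) (by exact_mod_cast hN.ne') ?_
      convert h using 1 <;> push_cast <;> ring
    exact_mod_cast (ZMod.intCast_zmod_eq_zero_iff_dvd _ _).2 h'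
  obtain ⟨d, hd⟩ := ZMod.exists_eq_intCast_mul_of_mul_eq_zero hM
    (x := (u * b + v * c : ZMod (M * q)))
    (by linear_combination (u : ZMod (M * q)) * hMb + v * hMc)
  have hM' : (0 : ℤ) < M := by exact_mod_cast hM
  refine ⟨d % M, Int.emod_nonneg _ hM'.ne', Int.emod_lt_of_pos _ hM', fun z => ?_⟩
  have hz := (mem_Zgrp_mul_iff hm0 hm1 z.1).1 z.2
  obtain ⟨k, hk⟩ := ZMod.exists_eq_intCast_mul_of_mul_eq_zero hM hz
  obtain ⟨s, hs⟩ := ZMod.intCast_surjective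
    (u * z.1.1 + v * z.1.2 : ZMod (M * q))
  have hzd : z = s • e + k • g := by
    ext
    · simp only [e, g, AddSubgroup.coe_add, AddSubgroup.coe_zsmul, Prod.fst_add, zsmul_eq_mul,
        Prod.fst_mul, Prod.fst_intCast]
      linear_combination -z.1.1 * huv' - m0 * hs - v * hk
    · simp only [e, g, AddSubgroup.coe_add, AddSubgroup.coe_zsmul, Prod.snd_add, zsmul_eq_mul,
        Prod.snd_mul, Prod.snd_intCast]
      linear_combination -z.1.2 * huv' - m1 * hs + u * hk
  have hφz : (φ z : ZMod (M * q) × ZMod (M * q)) =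
      ((k * b : ZMod (M * q)), (k * c : ZMod (M * q))) := by
    rw [hzd, map_add, map_zsmul, map_zsmul, he, smul_zero, zero_add, AddSubgroup.coe_zsmul]
    ext <;> simp [hb, hc]
  have hdk : ((d % M : ℤ) : ZMod (M * q)) * (k * q) = d * (k * q) := by
    have h : (d : ZMod (M * q)) = (d % M : ℤ) + M * (d / M : ℤ) := by
      exact_mod_cast congrArg (Int.cast : ℤ → ZMod (M * q)) (Int.emod_add_mul_ediv d M).symm
    linear_combination -(k * q : ZMod (M * q)) * h - k * (d / M : ℤ) * hMq
  rw [hφz, hk]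
  push_cast
  ext
  · linear_combination -(k * b : ZMod (M * q)) * huv' - m0 * hdk + k * m0 * hd - k * v * hbc
  · linear_combination -(k * c : ZMod (M * q)) * huv' - m1 * hdk + k * m1 * hd + k * u * hbc
end

section
/- Let m0, m1, m, p be positive integers with gcd(m0,m1) = 1, m0·m1 ∣ m and m ∣ p, and let d be an integer. The map sending (β,γ) ∈ ZMod p × ZMod p to (d·m0·(m0·γ − m1·β), d·m1·(m0·γ − m1·β)) vanishes on every element of Z(m,p) if and only if (m/(m0·m1)) ∣ d. -/
/-- (final claim in the proof of Lemma 4.1) For positive integers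
`m0, m1, m, p` with `gcd(m0,m1)=1`, `m0·m1 ∣ m`, `m ∣ p` and an integer `d`, the matrix
`d·[[−m1m0, m0m0], [−m1m1, m0m1]]` vanishes on every element of `Z(m,p)` if and only
if `m/(m0·m1)` divides `d`. -/
theorem stmt_7 (m0 m1 m p : ℕ) (hm0 : 0 < m0) (hm1 : 0 < m1) (hm : 0 < m) (hp : 0 < p)
    (hcop : Nat.gcd m0 m1 = 1) (hdm : m0 * m1 ∣ m) (hmp : m ∣ p) (d : ℤ) :
    (∀ z ∈ Zgrp m0 m1 m p,
      ((((d * m0 : ℤ) : ZMod p) * ((m0 : ZMod p) * z.2 - (m1 : ZMod p) * z.1),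
        ((d * m1 : ℤ) : ZMod p) * ((m0 : ZMod p) * z.2 - (m1 : ZMod p) * z.1))
          : ZMod p × ZMod p) = 0) ↔
    ((m / (m0 * m1) : ℕ) : ℤ) ∣ d := by
  obtain ⟨k, rfl⟩ := hdm
  obtain ⟨q, rfl⟩ := hmp
  have hq : 0 < q := Nat.pos_of_mul_pos_left hp
  have e0 : m0 * m1 * k / m0 = m1 * k := by
    rw [mul_assoc, Nat.mul_div_cancel_left _ hm0]
  have e1 : m0 * m1 * k / m1 = m0 * k := by
    rw [mul_comm m0 m1, mul_assoc, Nat.mul_div_cancel_left _ hm1]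
  have e2 : m0 * m1 * k / (m0 * m1) = k :=
    Nat.mul_div_cancel_left _ (Nat.mul_pos hm0 hm1)
  have mem_iff (z : ZMod (m0 * m1 * k * q) × ZMod (m0 * m1 * k * q)) :
      z ∈ Zgrp m0 m1 (m0 * m1 * k) (m0 * m1 * k * q) ↔
        (k : ZMod (m0 * m1 * k * q)) * (m0 * z.2 - m1 * z.1) = 0 := by
    change ((m0 * m1 * k / m1 : ℕ) : ZMod (m0 * m1 * k * q)) * z.2
      = ((m0 * m1 * k / m0 : ℕ) : ZMod (m0 * m1 * k * q)) * z.1 ↔ _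
    rw [e0, e1, ← sub_eq_zero]
    push_cast
    ring_nf
  rw [e2]
  constructor
  · intro h
    obtain ⟨u, v, huv⟩ : IsCoprime (m0 : ℤ) (m1 : ℤ) := Nat.isCoprime_iff_coprime.mpr hcop
    have huv' : (u : ZMod (m0 * m1 * k * q)) * m0 + v * m1 = 1 := by
      exact_mod_cast congrArg (Int.cast : ℤ → ZMod (m0 * m1 * k * q)) huv
    have hN : (m0 : ZMod (m0 * m1 * k * q)) * m1 * k * q = 0 := by
      exact_mod_cast ZMod.natCast_self (m0 * m1 * k * q)
    -- A preimage of `m0 * m1 * q`, a generator of the `k`-torsion, under `m0 * γ - m1 * β`.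
    have hz := h (-(v * (m0 * m1 * q)), u * (m0 * m1 * q)) <| by
      rw [mem_iff]
      linear_combination (u * m0 + v * m1 : ZMod (m0 * m1 * k * q)) * hN
    obtain ⟨h0, h1⟩ := Prod.mk_eq_zero.mp hz
    push_cast at h0 h1
    have hd : ((d * (m0 * m1 * q) : ℤ) : ZMod (m0 * m1 * k * q)) = 0 := by
      push_cast
      linear_combination (u : ZMod (m0 * m1 * k * q)) * h0 + v * h1
        - d * (m0 * m1 * q) * (u * m0 + v * m1 + 1) * huv'
    rw [ZMod.intCast_zmod_eq_zero_iff_dvd] at hd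
    have hne : (m0 * m1 * q : ℤ) ≠ 0 := by positivity
    obtain ⟨c, hc⟩ := hd
    refine ⟨c, mul_right_cancel₀ hne ?_⟩
    rw [hc]
    push_cast
    ring
  · rintro ⟨e, rfl⟩ z hz
    rw [mem_iff] at hz
    refine Prod.mk_eq_zero.mpr ⟨?_, ?_⟩ <;> push_cast
    · linear_combination (e * m0 : ZMod (m0 * m1 * k * q)) * hz
    · linear_combination (e * m1 : ZMod (m0 * m1 * k * q)) * hz
end

section
/- Let m0, m1, m, n, p be positive integers with gcd(m0,m1) = 1, m0·m1 ∣ m, m0·m1 ∣ n and m ∣ p, let β0, β1 be integers with β0·m0 + β1·m1 = 1, and let x be an integer. Define σ : ZMod p × ZMod p → ZMod p × ZMod p by σ(β,γ) = (x·m0·(β0·β + β1·γ), x·m1·(β0·β + β1·γ)) (integer coefficients cast into ZMod p). Then: (a) σ maps Z(m,p) into Z(n,p); (b) σ((m0 : ZMod p), (m1 : ZMod p)) = (x·m0, x·m1) in ZMod p × ZMod p; and (c) for every (β,γ) ∈ Z(m,p) and every pair of integers b', c' with ((b' : ZMod p), (c' : ZMod p)) = σ(β,γ), one has p·(n/(m0·m1))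 ∣ (n/m1)·c' − (n/m0)·b'. -/
/-- (Lemma 4.2) With `gcd(m0,m1)=1`, `m0·m1 ∣ m`, `m0·m1 ∣ n`, `m ∣ p`,
`β0·m0 + β1·m1 = 1` and an integer `x`, the map
`σ(β,γ) = (x·m0·(β0·β + β1·γ), x·m1·(β0·β + β1·γ))` (a) maps `Z(m,p)` into `Z(n,p)`,
(b) sends `(m̄0, m̄1)` to `(x·m̄0, x·m̄1)` (K₀-multiplicity `x`), and
(c) composes to zero with the Bockstein map `ν` of `I[m0,n,m1]` (K₁-multiplicity `0`). -/
theorem stmt_8 (m0 m1 m n p : ℕ) (hm0 : 0 < m0) (hm1 : 0 < m1) (hm : 0 < m)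
    (hn : 0 < n) (hp : 0 < p)
    (hcop : Nat.gcd m0 m1 = 1) (hdm : m0 * m1 ∣ m) (hdn : m0 * m1 ∣ n) (hmp : m ∣ p)
    (β0 β1 : ℤ) (hβ : β0 * m0 + β1 * m1 = 1) (x : ℤ)
    (σ : ZMod p × ZMod p → ZMod p × ZMod p)
    (hσ : ∀ z : ZMod p × ZMod p,
      σ z = (((x * m0 : ℤ) : ZMod p) * ((β0 : ZMod p) * z.1 + (β1 : ZMod p) * z.2),
             ((x * m1 : ℤ) : ZMod p) * ((β0 : ZMod p) * z.1 + (β1 : ZMod p) * z.2))) :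
    (∀ z ∈ Zgrp m0 m1 m p, σ z ∈ Zgrp m0 m1 n p) ∧
    σ ((m0 : ZMod p), (m1 : ZMod p)) = (((x * m0 : ℤ) : ZMod p), ((x * m1 : ℤ) : ZMod p)) ∧
    (∀ z ∈ Zgrp m0 m1 m p, ∀ b' c' : ℤ,
      (b' : ZMod p) = (σ z).1 → (c' : ZMod p) = (σ z).2 →
      ((p * (n / (m0 * m1)) : ℕ) : ℤ) ∣
        ((n / m1 : ℕ) : ℤ) * c' - ((n / m0 : ℕ) : ℤ) * b') := by
  obtain ⟨k, rfl⟩ := hdn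
  have h1 : m0 * m1 * k / m1 = m0 * k :=
    Nat.div_eq_of_eq_mul_left hm1 (by ring)
  have h0 : m0 * m1 * k / m0 = m1 * k :=
    Nat.div_eq_of_eq_mul_left hm0 (by ring)
  have h01 : m0 * m1 * k / (m0 * m1) = k :=
    Nat.mul_div_cancel_left k (Nat.mul_pos hm0 hm1)
  refine ⟨fun z _ => ?_, ?_, fun z _ b c hb hc => ?_⟩
  · change ((m0 * m1 * k / m1 : ℕ) : ZMod p) * (σ z).2
      = ((m0 * m1 * k / m0 : ℕ) : ZMod p) * (σ z).1
    rw [h0, h1, hσ]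
    push_cast
    ring
  · have hβp : (β0 : ZMod p) * m0 + β1 * m1 = 1 := by
      exact_mod_cast congrArg (Int.cast : ℤ → ZMod p) hβ
    rw [hσ, hβp, mul_one, mul_one]
  · obtain ⟨t, ht⟩ := ZMod.intCast_surjective ((β0 : ZMod p) * z.1 + (β1 : ZMod p) * z.2)
    rw [hσ, ← ht] at hb hc
    obtain ⟨u, hu⟩ : (p : ℤ) ∣ b - x * m0 * t := by
      rw [← ZMod.intCast_eq_intCast_iff_dvd_sub, hb]
      push_cast
      rfl
    obtain ⟨v, hv⟩ : (p : ℤ) ∣ c - x * m1 * t := by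
      rw [← ZMod.intCast_eq_intCast_iff_dvd_sub, hc]
      push_cast
      rfl
    rw [h0, h1, h01]
    refine ⟨m0 * v - m1 * u, ?_⟩
    push_cast
    linear_combination (m0 * k : ℤ) * hv - (m1 * k : ℤ) * hu
end

section
/- Let m0, m1, m, n, p be positive integers with gcd(m0,m1) = 1, m0·m1 ∣ m, m0·m1 ∣ n and m ∣ p, let β0, β1 be integers with β0·m0 + β1·m1 = 1, and let y be an integer such that n ∣ m·y. Define ψ : ZMod p × ZMod p → ZMod p × ZMod p by ψ(β,γ) = ((m·y/n)·β1·(m1·β − m0·γ), (m·y/n)·β0·(m0·γ − m1·β)) (integer coefficients cast into ZMod p). Then: (a) ψ maps Z(m,p) into Z(n,p); (b) ψ((m0 : ZMod p), (m1 : ZMod p)) = 0; and (c) for all integers b, c with p ∣ (m/m1)·c − (m/m0)·b and all integers b', c' with ((b' : ZMod p), (c' : ZMod p)) = ψ((b : ZMod p), (c : ZMod p)), one has p·(n/(m0·m1)) ∣ ((n/m1)·c' − (n/m0)·b') − y·((m/m1)·c − (m/m0)·b). -/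
/-- (Lemma 4.3) With `gcd(m0,m1)=1`, `m0·m1 ∣ m`, `m0·m1 ∣ n`, `m ∣ p`,
`β0·m0 + β1·m1 = 1` and an integer `y` with `n ∣ m·y`, the map
`ψ(β,γ) = ((m·y/n)·β1·(m1·β − m0·γ), (m·y/n)·β0·(m0·γ − m1·β))`
(a) maps `Z(m,p)` into `Z(n,p)`, (b) kills `(m̄0, m̄1)` (K₀-multiplicity `0`), and
(c) satisfies `ν_B ∘ ψ = y·ν_A` for the Bockstein maps `ν` (K₁-multiplicity `y`). -/
theorem stmt_9 (m0 m1 m n p : ℕ) (hm0 : 0 < m0) (hm1 : 0 < m1) (hm : 0 < m)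
    (hn : 0 < n) (hp : 0 < p)
    (hcop : Nat.gcd m0 m1 = 1) (hdm : m0 * m1 ∣ m) (hdn : m0 * m1 ∣ n) (hmp : m ∣ p)
    (β0 β1 : ℤ) (hβ : β0 * m0 + β1 * m1 = 1) (y : ℤ) (hy : (n : ℤ) ∣ (m : ℤ) * y)
    (ψ : ZMod p × ZMod p → ZMod p × ZMod p)
    (hψ : ∀ z : ZMod p × ZMod p,
      ψ z = ((((m : ℤ) * y / n * β1 : ℤ) : ZMod p) *
               ((m1 : ZMod p) * z.1 - (m0 : ZMod p) * z.2),
             (((m : ℤ) * y / n * β0 : ℤ) : ZMod p) *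
               ((m0 : ZMod p) * z.2 - (m1 : ZMod p) * z.1))) :
    (∀ z ∈ Zgrp m0 m1 m p, ψ z ∈ Zgrp m0 m1 n p) ∧
    ψ ((m0 : ZMod p), (m1 : ZMod p)) = 0 ∧
    (∀ b c : ℤ,
      (p : ℤ) ∣ ((m / m1 : ℕ) : ℤ) * c - ((m / m0 : ℕ) : ℤ) * b →
      ∀ b' c' : ℤ,
        (b' : ZMod p) = (ψ ((b : ZMod p), (c : ZMod p))).1 →
        (c' : ZMod p) = (ψ ((b : ZMod p), (c : ZMod p))).2 →
        ((p * (n / (m0 * m1)) : ℕ) : ℤ) ∣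
          (((n / m1 : ℕ) : ℤ) * c' - ((n / m0 : ℕ) : ℤ) * b') -
            y * (((m / m1 : ℕ) : ℤ) * c - ((m / m0 : ℕ) : ℤ) * b)) := by
  obtain ⟨k, rfl⟩ := hdm
  obtain ⟨l, rfl⟩ := hdn
  have hkm1 : m0 * m1 * k / m1 = m0 * k :=
    Nat.div_eq_of_eq_mul_left hm1 (by ring)
  have hkm0 : m0 * m1 * k / m0 = m1 * k :=
    Nat.div_eq_of_eq_mul_left hm0 (by ring)
  have hlm1 : m0 * m1 * l / m1 = m0 * l :=
    Nat.div_eq_of_eq_mul_left hm1 (by ring)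
  have hlm0 : m0 * m1 * l / m0 = m1 * l :=
    Nat.div_eq_of_eq_mul_left hm0 (by ring)
  have hl : m0 * m1 * l / (m0 * m1) = l :=
    Nat.mul_div_cancel_left l (Nat.mul_pos hm0 hm1)
  obtain ⟨t, ht⟩ := hy
  have hdiv : ((m0 * m1 * k : ℕ) : ℤ) * y / ((m0 * m1 * l : ℕ) : ℤ) = t := by
    rw [ht]
    exact Int.mul_ediv_cancel_left t (by exact_mod_cast hn.ne')
  have hkl : (k : ℤ) * y = l * t := by
    have h01 : ((m0 : ℤ) * m1) ≠ 0 := by exact_mod_cast (Nat.mul_pos hm0 hm1).ne'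
    apply mul_left_cancel₀ h01
    push_cast at ht
    linear_combination ht
  simp only [hdiv] at hψ
  refine ⟨fun z hz => ?_, ?_, fun b c _ b' c' hb' hc' => ?_⟩
  · have hβp : (β0 : ZMod p) * m0 + β1 * m1 = 1 := by
      exact_mod_cast congrArg (Int.cast : ℤ → ZMod p) hβ
    have hklp : (k : ZMod p) * y = l * t := by
      exact_mod_cast congrArg (Int.cast : ℤ → ZMod p) hkl
    change ((m0 * m1 * k / m1 : ℕ) : ZMod p) * z.2 = ((m0 * m1 * k / m0 : ℕ) : ZMod p) * z.1 at hz
    change ((m0 * m1 * l / m1 : ℕ) : ZMod p) * (ψ z).2 =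
      ((m0 * m1 * l / m0 : ℕ) : ZMod p) * (ψ z).1
    rw [hkm1, hkm0] at hz
    rw [hlm1, hlm0, hψ]
    push_cast at hz ⊢
    linear_combination (l * t * (m0 * z.2 - m1 * z.1) : ZMod p) * hβp
      - (m0 * z.2 - m1 * z.1) * hklp + y * hz
  · rw [hψ]
    ext <;> simp [mul_comm]
  · rw [hψ] at hb' hc'
    obtain ⟨u, hu⟩ : (p : ℤ) ∣ b' - t * β1 * (m1 * b - m0 * c) := by
      rw [← ZMod.intCast_eq_intCast_iff_dvd_sub]
      push_cast
      simpa using hb'.symm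
    obtain ⟨v, hv⟩ : (p : ℤ) ∣ c' - t * β0 * (m0 * c - m1 * b) := by
      rw [← ZMod.intCast_eq_intCast_iff_dvd_sub]
      push_cast
      simpa using hc'.symm
    rw [hkm1, hkm0, hlm1, hlm0, hl]
    refine ⟨m0 * v - m1 * u, ?_⟩
    push_cast
    linear_combination (m0 * l : ℤ) * hv - (m1 * l : ℤ) * hu
      + (l * t * (m0 * c - m1 * b) : ℤ) * hβ - (m0 * c - m1 * b : ℤ) * hkl
end

section
/- Let m0, m1, m, n, p be positive integers with gcd(m0,m1) = 1, m0·m1 ∣ m, m0·m1 ∣ n and m ∣ p, let β0, β1 be integers with β0·m0 + β1·m1 = 1, and let x, y be integers with n ∣ m·y. Let φ be an additive map from Z(m,p) to Z(n,p) such that: (i) φ((m0 : ZMod p), (m1 : ZMod p)) = (x·m0, x·m1) in ZMod p × ZMod p, and (ii) for all integers b, c with p ∣ (m/m1)·c − (m/m0)·b and all integers b', c' with ((b' : ZMod p), (c' : ZMod p)) = φ((b : ZMod p), (c : ZMod p)), one has p·(n/(m0·m1)) ∣ ((n/m1)·c' − (n/m0)·b') − y·((m/m1)·c − (m/m0)·b).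 Then there exists an integer d such that for every (β,γ) ∈ Z(m,p), φ(β,γ) = ((x·m0·β0 + (m·y/n)·m1·β1)·β + (x·m0·β1 − (m·y/n)·m0·β1)·γ + d·m0·(m0·γ − m1·β), (x·m1·β0 − (m·y/n)·m1·β0)·β + (x·m1·β1 + (m·y/n)·m0·β0)·γ + d·m1·(m0·γ − m1·β)) (all integer coefficients cast into ZMod p). -/
/-- Integer pairs `(b, c)` with `p ∣ (m/m1)·c − (m/m0)·b` reduce to elements of `Z(m,p)`. -/
lemma mem_Zgrp_of_dvd (m0 m1 m p : ℕ) {b c : ℤ}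
    (h : (p : ℤ) ∣ ((m / m1 : ℕ) : ℤ) * c - ((m / m0 : ℕ) : ℤ) * b) :
    (((b : ℤ) : ZMod p), ((c : ℤ) : ZMod p)) ∈ Zgrp m0 m1 m p := by
  show ((m / m1 : ℕ) : ZMod p) * ((c : ℤ) : ZMod p) = ((m / m0 : ℕ) : ZMod p) * ((b : ℤ) : ZMod p)
  have h2 := (ZMod.intCast_zmod_eq_zero_iff_dvd _ p).mpr h
  simp only [Int.cast_sub, Int.cast_mul, Int.cast_natCast] at h2
  linear_combination h2

/-- (Theorem 4.4, structure of `Hom(K(A_m;p), K(B_n;p))`) Every additive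
map `φ : Z(m,p) → Z(n,p)` compatible with the Bockstein maps `μ` and `ν` with
K₀-multiplicity `x` and K₁-multiplicity `y` equals the explicit matrix of Lemmas 4.2,
4.3 plus a torsion term `d·[[−m1m0, m0m0], [−m1m1, m0m1]]`. -/
theorem stmt_10 (m0 m1 m n p : ℕ) (hm0 : 0 < m0) (hm1 : 0 < m1) (hm : 0 < m)
    (hn : 0 < n) (hp : 0 < p)
    (hcop : Nat.gcd m0 m1 = 1) (hdm : m0 * m1 ∣ m) (hdn : m0 * m1 ∣ n) (hmp : m ∣ p)
    (β0 β1 : ℤ) (hβ : β0 * m0 + β1 * m1 = 1)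
    (x y : ℤ) (hy : (n : ℤ) ∣ (m : ℤ) * y)
    (φ : Zgrp m0 m1 m p →+ Zgrp m0 m1 n p)
    (hmu : (φ ⟨((m0 : ZMod p), (m1 : ZMod p)), mem_Zgrp_pair m0 m1 m p hdm⟩
        : ZMod p × ZMod p) = (((x * m0 : ℤ) : ZMod p), ((x * m1 : ℤ) : ZMod p)))
    (hnu : ∀ b c : ℤ,
      ∀ hbc : (p : ℤ) ∣ ((m / m1 : ℕ) : ℤ) * c - ((m / m0 : ℕ) : ℤ) * b,
      ∀ b' c' : ℤ,
        (b' : ZMod p) = (φ ⟨(((b : ℤ) : ZMod p), ((c : ℤ) : ZMod p)),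
            mem_Zgrp_of_dvd m0 m1 m p hbc⟩ : ZMod p × ZMod p).1 →
        (c' : ZMod p) = (φ ⟨(((b : ℤ) : ZMod p), ((c : ℤ) : ZMod p)),
            mem_Zgrp_of_dvd m0 m1 m p hbc⟩ : ZMod p × ZMod p).2 →
        ((p * (n / (m0 * m1)) : ℕ) : ℤ) ∣
          (((n / m1 : ℕ) : ℤ) * c' - ((n / m0 : ℕ) : ℤ) * b') -
            y * (((m / m1 : ℕ) : ℤ) * c - ((m / m0 : ℕ) : ℤ) * b)) :
    ∃ d : ℤ, ∀ z : Zgrp m0 m1 m p,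
      (φ z : ZMod p × ZMod p) =
        (((x * m0 * β0 + (m : ℤ) * y / n * m1 * β1 : ℤ) : ZMod p) * (z : ZMod p × ZMod p).1 +
           ((x * m0 * β1 - (m : ℤ) * y / n * m0 * β1 : ℤ) : ZMod p) * (z : ZMod p × ZMod p).2 +
           ((d * m0 : ℤ) : ZMod p) *
             ((m0 : ZMod p) * (z : ZMod p × ZMod p).2 - (m1 : ZMod p) * (z : ZMod p × ZMod p).1),
         ((x * m1 * β0 - (m : ℤ) * y / n * m1 * β0 : ℤ) : ZMod p) * (z : ZMod p × ZMod p).1 +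
           ((x * m1 * β1 + (m : ℤ) * y / n * m0 * β0 : ℤ) : ZMod p) * (z : ZMod p × ZMod p).2 +
           ((d * m1 : ℤ) : ZMod p) *
             ((m0 : ZMod p) * (z : ZMod p × ZMod p).2 - (m1 : ZMod p) * (z : ZMod p × ZMod p).1)) := by
  obtain ⟨k, rfl⟩ := hdm
  obtain ⟨l, rfl⟩ := hdn
  obtain ⟨q, hpq⟩ := hmp
  have hk : 0 < k := Nat.pos_of_mul_pos_left hm
  have hl : 0 < l := Nat.pos_of_mul_pos_left hn
  have div_left (j : ℕ) : m0 * m1 * j / m1 = m0 * j :=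
    Nat.div_eq_of_eq_mul_left hm1 (by ring)
  have div_right (j : ℕ) : m0 * m1 * j / m0 = m1 * j :=
    Nat.div_eq_of_eq_mul_left hm0 (by ring)
  have div_both : m0 * m1 * l / (m0 * m1) = l :=
    Nat.mul_div_cancel_left l (Nat.mul_pos hm0 hm1)
  have hm0' : (m0 : ℤ) ≠ 0 := by positivity
  have hm1' : (m1 : ℤ) ≠ 0 := by positivity
  have hk' : (k : ℤ) ≠ 0 := by positivity
  have hl' : (l : ℤ) ≠ 0 := by positivity
  obtain ⟨N, hN⟩ := hy
  have hquot : ((m0 * m1 * k : ℕ) : ℤ) * y / ((m0 * m1 * l : ℕ) : ℤ) = N := by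
    rw [hN]
    exact Int.mul_ediv_cancel_left _ (by positivity)
  have hNl : (k : ℤ) * y = l * N := by
    apply mul_left_cancel₀ (mul_ne_zero hm0' hm1')
    push_cast at hN
    linear_combination hN
  rw [hquot]
  simp only [div_left, div_right, div_both] at hnu
  have hpz : (p : ℤ) = k * (m0 * m1 * q) := by rw [hpq]; push_cast; ring
  set P : ℤ := m0 * m1 * q with hP
  have hw : (p : ℤ) ∣ ((m0 * k : ℕ) : ℤ) * (P * β0) - ((m1 * k : ℕ) : ℤ) * (-(P * β1)) := by
    refine ⟨1, ?_⟩
    rw [hpz]; push_cast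
    linear_combination (k : ℤ) * P * hβ
  have hwZ : (((-(P * β1) : ℤ) : ZMod p), ((P * β0 : ℤ) : ZMod p)) ∈
      Zgrp m0 m1 (m0 * m1 * k) p :=
    mem_Zgrp_of_dvd m0 m1 _ p (by rw [div_left, div_right]; exact hw)
  obtain ⟨b', hb'⟩ := ZMod.intCast_surjective (φ ⟨_, hwZ⟩ : ZMod p × ZMod p).1
  obtain ⟨c', hc'⟩ := ZMod.intCast_surjective (φ ⟨_, hwZ⟩ : ZMod p × ZMod p).2
  obtain ⟨e, he⟩ := hnu _ _ hw b' c' hb' hc'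
  have ht : (m0 : ℤ) * c' - m1 * b' = N * P + p * e := by
    apply mul_left_cancel₀ hl'
    rw [hpq]
    rw [hpq] at he
    push_cast at he ⊢
    linear_combination he + P * hNl + y * k * P * hβ
  have hkw : k • (⟨_, hwZ⟩ : Zgrp m0 m1 (m0 * m1 * k) p) = 0 := by
    have h0 : ((k * P : ℤ) : ZMod p) = 0 := by
      rw [← hpz]; simp
    push_cast at h0
    ext
    · simp only [AddSubgroup.coe_nsmul, Prod.smul_fst, ZeroMemClass.coe_zero,
        Prod.fst_zero]
      simp only [nsmul_eq_mul]
      push_cast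
      linear_combination (-(β1 : ZMod p)) * h0
    · simp only [AddSubgroup.coe_nsmul, Prod.smul_snd, ZeroMemClass.coe_zero,
        Prod.snd_zero]
      simp only [nsmul_eq_mul]
      push_cast
      linear_combination (β0 : ZMod p) * h0
  have hkφ : k • (φ ⟨_, hwZ⟩ : ZMod p × ZMod p) = 0 := by
    rw [← AddSubgroup.coe_nsmul, ← map_nsmul, hkw, map_zero, ZeroMemClass.coe_zero]
  have hd : P ∣ β0 * b' + β1 * c' := by
    have h1 : ((k * (β0 * b' + β1 * c') : ℤ) : ZMod p) = 0 := by
      have hf := congrArg Prod.fst hkφ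
      have hs := congrArg Prod.snd hkφ
      simp only [Prod.smul_fst, Prod.smul_snd, Prod.fst_zero, Prod.snd_zero,
        ← hb', ← hc'] at hf hs
      simp only [nsmul_eq_mul] at hf hs
      push_cast
      linear_combination (β0 : ZMod p) * hf + (β1 : ZMod p) * hs
    rw [ZMod.intCast_zmod_eq_zero_iff_dvd, hpz] at h1
    exact Int.dvd_of_mul_dvd_mul_left hk' h1
  obtain ⟨d, hd⟩ := hd
  refine ⟨d, ?_⟩
  rintro ⟨⟨zb, zc⟩, hz⟩
  obtain ⟨b, rfl⟩ := ZMod.intCast_surjective zb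
  obtain ⟨c, rfl⟩ := ZMod.intCast_surjective zc
  obtain ⟨r, hr⟩ : P ∣ m0 * c - m1 * b := by
    have h1 : ((m0 * m1 * k / m1 : ℕ) : ZMod p) * (c : ZMod p) =
      ((m0 * m1 * k / m0 : ℕ) : ZMod p) * (b : ZMod p) := hz
    rw [div_left, div_right] at h1
    push_cast at h1
    have h2 : ((k * (m0 * c - m1 * b) : ℤ) : ZMod p) = 0 := by
      push_cast
      linear_combination h1
    rw [ZMod.intCast_zmod_eq_zero_iff_dvd, hpz] at h2
    exact Int.dvd_of_mul_dvd_mul_left hk' h2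
  have hβ' : (β0 : ZMod p) * m0 + β1 * m1 = 1 := by
    exact_mod_cast congrArg (Int.cast (R := ZMod p)) hβ
  have hr' : (m0 : ZMod p) * c - m1 * b = P * r := by
    exact_mod_cast congrArg (Int.cast (R := ZMod p)) hr
  have hd' : (β0 : ZMod p) * b' + β1 * c' = P * d := by
    exact_mod_cast congrArg (Int.cast (R := ZMod p)) hd
  have ht' : (m0 : ZMod p) * c' - m1 * b' = N * P := by
    have := congrArg (Int.cast (R := ZMod p)) ht
    push_cast at this
    rw [this, ZMod.natCast_self]
    ring
  have hdecomp : (⟨((b : ZMod p), (c : ZMod p)), hz⟩ : Zgrp m0 m1 (m0 * m1 * k) p) =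
      (β0 * b + β1 * c) • ⟨((m0 : ZMod p), (m1 : ZMod p)), mem_Zgrp_pair m0 m1 _ p ⟨k, rfl⟩⟩ +
        r • ⟨_, hwZ⟩ := by
    ext
    · simp only [AddSubgroup.coe_add, AddSubgroup.coe_zsmul, Prod.fst_add, Prod.smul_fst]
      simp only [zsmul_eq_mul]
      push_cast
      linear_combination (-(b : ZMod p)) * hβ' - (β1 : ZMod p) * hr'
    · simp only [AddSubgroup.coe_add, AddSubgroup.coe_zsmul, Prod.snd_add, Prod.smul_snd]
      simp only [zsmul_eq_mul]
      push_cast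
      linear_combination (-(c : ZMod p)) * hβ' + (β0 : ZMod p) * hr'
  rw [hdecomp, map_add, map_zsmul, map_zsmul, AddSubgroup.coe_add, AddSubgroup.coe_zsmul,
    AddSubgroup.coe_zsmul, hmu, ← hdecomp]
  ext
  · simp only [Prod.fst_add, Prod.smul_fst, ← hb']
    simp only [zsmul_eq_mul]
    push_cast
    linear_combination (-(r : ZMod p) * b') * hβ' + (r : ZMod p) * m0 * hd' -
      (r : ZMod p) * β1 * ht' - ((d : ZMod p) * m0 - N * β1) * hr'
  · simp only [Prod.snd_add, Prod.smul_snd, ← hc']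
    simp only [zsmul_eq_mul]
    push_cast
    linear_combination (-(r : ZMod p) * c') * hβ' + (r : ZMod p) * m1 * hd' +
      (r : ZMod p) * β0 * ht' - ((d : ZMod p) * m1 + N * β0) * hr'
end

section
/- Let m0, m1, m, p be positive integers with gcd(m0,m1) = 1, m0·m1 ∣ m and m ∣ p; let β0, β1 be integers with β0 ≥ 0, β1 ≤ 0 and β0·m0 + β1·m1 = 1; let x be an integer and d an integer with d ≥ 0 and (d·m0·m0·m1 < m or d·m0·m1·m1 < m). Define Φ : ℤ × ZMod p × ZMod p → ℤ × ZMod p × ZMod p by Φ(a, β, γ) = (x·a, (x·m0·β0 − d·m1·m0)·β + (x·m0·β1 + d·m0·m0)·γ, (x·m1·β0 − d·m1·m1)·β + (x·m1·β1 + d·m0·m1)·γ). Suppose that Φ(g) is positive for each g among (1,0,0), (1, m̄0, m̄1), (p/m, 0, (p/m)·m̄1), and (p/m, (p/m)·m̄0, 0), where a triple (a,β,γ) is called positive if there exist natural numbers b, c with (b : ZMod p) = β, (c : ZMod p) = γ, b ≤ a·m0 and c ≤ a·m1. Then β0·x − d·m1 ≥ 0. -/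
/-- The Dadarlat–Loring positivity of a triple `(a, β, γ) ∈ ℤ × ZMod p × ZMod p`
(modelling membership in the positive cone of `K0(I[m0,n,m1]; ℤ ⊕ ℤ/p)`): there are
natural numbers `b, c` representing `β, γ` with `b ≤ a·m0` and `c ≤ a·m1`. -/
def IsPos (m0 m1 p : ℕ) (t : ℤ × ZMod p × ZMod p) : Prop :=
  ∃ b c : ℕ, (b : ZMod p) = t.2.1 ∧ (c : ZMod p) = t.2.2 ∧
    (b : ℤ) ≤ t.1 * m0 ∧ (c : ℤ) ≤ t.1 * m1

/-- If `A < 0`, no natural number congruent to `k·s·m0·A` modulo `k·m` is at most `k·s·x`, where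
`x = A·m0 + B·m1`, as soon as `s·m1·B < m`. -/
theorem nonneg_of_residue_le {k m b : ℕ} (hk : 0 < k) {s m0 m1 A B x : ℤ} (hs : 0 < s)
    (hm0 : 0 < m0) (hx : A * m0 + B * m1 = x) (hB : s * m1 * B < m)
    (hb : ((m * k : ℕ) : ℤ) ∣ b - k * (s * m0 * A)) (hle : (b : ℤ) ≤ x * k * s) : 0 ≤ A := by
  by_contra! hA
  obtain ⟨t, ht⟩ := hb
  have hk' : (0 : ℤ) < k := by exact_mod_cast hk
  have hbt : (b : ℤ) = k * (s * m0 * A + m * t) := by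
    push_cast at ht
    linear_combination ht
  have hneg : s * m0 * A < 0 := mul_neg_of_pos_of_neg (mul_pos hs hm0) hA
  have hnn : 0 ≤ s * m0 * A + m * t :=
    nonneg_of_mul_nonneg_right (by rw [← hbt]; positivity) hk'
  have ht1 : 0 < t := pos_of_mul_pos_right (by linarith : (0 : ℤ) < m * t) (by positivity)
  have hmt : (m : ℤ) ≤ m * t := le_mul_of_one_le_right (by positivity) ht1
  have hle' : k * (s * m0 * A + m * t) ≤ k * (s * x) := by
    rw [← hbt]
    linarith
  have := le_of_mul_le_mul_left hle' hk'
  rw [← hx] at this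
  linarith

/-- (Proposition 5.4) Suppose `gcd(m0,m1)=1`, `m0·m1 ∣ m`, `m ∣ p`,
`β0 ≥ 0 ≥ β1`, `β0·m0 + β1·m1 = 1`, `d ≥ 0` and `d·m0·m0·m1 < m` or `d·m0·m1·m1 < m`.
If the map `Φ` induced on `K0(·; ℤ ⊕ ℤ/p)` by the KK-element
`(β0x − dm1)·δ0 + (β1x + dm0)·δ1` sends the four generators `[δ0]`, `[δ1]`, `[id]`,
`[id‾]` of the Dadarlat–Loring positive cone to positive triples, then
`β0·x − d·m1 ≥ 0`. -/
theorem stmt_11 (m0 m1 m p : ℕ) (hm0 : 0 < m0) (hm1 : 0 < m1) (hm : 0 < m) (hp : 0 < p)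
    (hcop : Nat.gcd m0 m1 = 1) (hdm : m0 * m1 ∣ m) (hmp : m ∣ p)
    (β0 β1 : ℤ) (hβ0 : 0 ≤ β0) (hβ1 : β1 ≤ 0) (hβ : β0 * m0 + β1 * m1 = 1)
    (x d : ℤ) (hd0 : 0 ≤ d)
    (hd : d * m0 * m0 * m1 < (m : ℤ) ∨ d * m0 * m1 * m1 < (m : ℤ))
    (Φ : ℤ × ZMod p × ZMod p → ℤ × ZMod p × ZMod p)
    (hΦ : ∀ t : ℤ × ZMod p × ZMod p,
      Φ t = (x * t.1,
        ((x * m0 * β0 - d * m1 * m0 : ℤ) : ZMod p) * t.2.1 +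
          ((x * m0 * β1 + d * m0 * m0 : ℤ) : ZMod p) * t.2.2,
        ((x * m1 * β0 - d * m1 * m1 : ℤ) : ZMod p) * t.2.1 +
          ((x * m1 * β1 + d * m0 * m1 : ℤ) : ZMod p) * t.2.2))
    (h1 : IsPos m0 m1 p (Φ (1, 0, 0)))
    (h2 : IsPos m0 m1 p (Φ (1, (m0 : ZMod p), (m1 : ZMod p))))
    (h3 : IsPos m0 m1 p (Φ (((p / m : ℕ) : ℤ), 0, ((p / m * m1 : ℕ) : ZMod p))))
    (h4 : IsPos m0 m1 p (Φ (((p / m : ℕ) : ℤ), ((p / m * m0 : ℕ) : ZMod p), 0))) :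
    0 ≤ β0 * x - d * m1 := by
  rw [hΦ] at h1 h4
  obtain ⟨b₀, -, -, -, hb₀, -⟩ := h1
  obtain ⟨b, c, hb, hc, hbx, hcx⟩ := h4
  obtain ⟨k, rfl⟩ := hmp
  have hk : 0 < k := Nat.pos_of_mul_pos_left hp
  simp only [Nat.mul_div_cancel_left k hm] at hb hc hbx hcx
  have hm0' : (0 : ℤ) < m0 := by exact_mod_cast hm0
  have hm1' : (0 : ℤ) < m1 := by exact_mod_cast hm1
  have hx : 0 ≤ x := by
    refine nonneg_of_mul_nonneg_left (b := (m0 : ℤ)) ?_ hm0'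
    have : (0 : ℤ) ≤ b₀ := by positivity
    simp only [mul_one] at hb₀
    linarith
  have hβx : β1 * x ≤ 0 := mul_nonpos_of_nonpos_of_nonneg hβ1 hx
  have hsum : (β0 * x - d * m1) * m0 + (β1 * x + d * m0) * m1 = x := by
    linear_combination x * hβ
  rcases hd with hd | hd
  · refine nonneg_of_residue_le (m := m) (b := b) hk hm0' hm0' hsum ?_ ?_ hbx
    · have : (m0 * m1 : ℤ) * (β1 * x) ≤ 0 :=
        mul_nonpos_of_nonneg_of_nonpos (by positivity) hβx
      linarith
    · rw [← CharP.intCast_eq_zero_iff (ZMod (m * k)) (m * k)]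
      push_cast
      rw [hb]
      push_cast
      ring
  · refine nonneg_of_residue_le (m := m) (b := c) hk hm1' hm0' hsum ?_ ?_ hcx
    · have : (m1 * m1 : ℤ) * (β1 * x) ≤ 0 :=
        mul_nonpos_of_nonneg_of_nonpos (by positivity) hβx
      linarith
    · rw [← CharP.intCast_eq_zero_iff (ZMod (m * k)) (m * k)]
      push_cast
      rw [hc]
      push_cast
      ring
end

section
/- Let m0, m1, m be positive integers with gcd(m0,m1) = 1 and m0·m1 ∣ m; let β0, β1 be integers with β0 ≥ 0, β1 ≤ 0 and β0·m0 + β1·m1 = 1; let d be an integer with 0 ≤ d < m/(m0·m1), and let x be an integer with x ≥ m. Then there exists an integer k such that β0·x − d·m1 − k·(m/m0) ≥ 0 and β1·x + d·m0 + k·(m/m1) ≥ 0. -/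
/-- (arithmetic content of Proposition 5.6) Let `gcd(m0,m1)=1`,
`m0·m1 ∣ m`, `β0 ≥ 0 ≥ β1` with `β0·m0 + β1·m1 = 1`, `0 ≤ d < m/(m0·m1)` and `x ≥ m`.
Then the coefficient pair `(β0·x − d·m1, β1·x + d·m0)` of the KK-element
`(β0x − dm1)·δ0 + (β1x + dm0)·δ1` can be made nonnegative by adding an integer
multiple of `(−(m/m0), m/m1)` (the K-homology relation `(m/m0)·δ0 = (m/m1)·δ1`),
so the KK-element lifts to a `*`-homomorphism. -/
theorem stmt_12 (m0 m1 m : ℕ) (hm0 : 0 < m0) (hm1 : 0 < m1) (hm : 0 < m)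
    (hcop : Nat.gcd m0 m1 = 1) (hdm : m0 * m1 ∣ m)
    (β0 β1 : ℤ) (hβ0 : 0 ≤ β0) (hβ1 : β1 ≤ 0) (hβ : β0 * m0 + β1 * m1 = 1)
    (d : ℤ) (hd0 : 0 ≤ d) (hd : d < ((m / (m0 * m1) : ℕ) : ℤ))
    (x : ℤ) (hx : (m : ℤ) ≤ x) :
    ∃ k : ℤ, 0 ≤ β0 * x - d * m1 - k * ((m / m0 : ℕ) : ℤ) ∧
      0 ≤ β1 * x + d * m0 + k * ((m / m1 : ℕ) : ℤ) := by
  obtain ⟨c, rfl⟩ := hdm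
  have h0 : m0 * m1 * c / m0 = m1 * c := by
    rw [mul_assoc, Nat.mul_div_cancel_left _ hm0]
  have h1 : m0 * m1 * c / m1 = m0 * c := by
    rw [mul_comm m0 m1, mul_assoc, Nat.mul_div_cancel_left _ hm1]
  rw [h0, h1]
  have hc : 0 < c := Nat.pos_of_mul_pos_left hm
  have hpos : (0 : ℤ) < ((m1 * c : ℕ) : ℤ) := by exact_mod_cast Nat.mul_pos hm1 hc
  have hm0' : (0 : ℤ) < m0 := by exact_mod_cast hm0
  have hm1' : (0 : ℤ) < m1 := by exact_mod_cast hm1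
  set A : ℤ := β0 * x - d * m1 with hA
  have hdiv := Int.emod_add_mul_ediv A ((m1 * c : ℕ) : ℤ)
  have hr0 := Int.emod_nonneg A hpos.ne'
  have hr1 := Int.emod_lt_of_pos A hpos
  set k := A / ((m1 * c : ℕ) : ℤ)
  set r := A % ((m1 * c : ℕ) : ℤ)
  refine ⟨k, by linarith, ?_⟩
  push_cast at hdiv hr1 hx ⊢
  have key : (β1 * x + d * m0 + k * (m0 * c)) * m1 = x - m0 * r := by
    linear_combination x * hβ + (m0 : ℤ) * hdiv + (m0 : ℤ) * hA
  have hr : (m0 : ℤ) * r ≤ m0 * (m1 * c) := mul_le_mul_of_nonneg_left hr1.le hm0'.le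
  refine nonneg_of_mul_nonneg_left ?_ hm1'
  rw [key]
  linarith
end

section
/- Let m0, m1, m, p be positive integers with m0 ≥ 2, m1 ≥ 2, gcd(m0,m1) = 1, m0·m1 ∣ m and m ∣ p; let β0, β1 be integers with β0 ≥ 0, β1 ≤ 0 and β0·m0 + β1·m1 = 1, and let x be an integer. Define Φ : ℤ × ZMod p × ZMod p → ℤ × ZMod p × ZMod p by Φ(a, β, γ) = (x·a, x·m0·(β0·β + β1·γ), x·m1·(β0·β + β1·γ)), and let R and S be the remainders of β0·m0·m0·x and β0·m0·m1·x upon division by m (integers in [0, m)). Then Φ(g) is positive for each g among (1,0,0), (1, m̄0, m̄1), (p/m, 0, (p/m)·m̄1), (p/m, (p/m)·m̄0, 0) — where (a,β,γ) is called positive if there exist natural numbers b, c with (b : ZMod p) = β, (c : ZMod p) = γ, b ≤ a·m0 and c ≤ a·m1 — if and only if x = 0, or all of the following hold: β0·m0·m0·x ≥ m, β0·m0·m1·x ≥ m, m0·x ≥ R, and m1·x ≥ S. -/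
theorem Int.emod_le_self_of_nonneg {a : ℤ} (ha : 0 ≤ a) (n : ℕ) : a % n ≤ a := by
  lift a to ℕ using ha
  exact_mod_cast Nat.mod_le a n

/-- Positivity of a triple whose torsion entries are given by integers is a condition on
their least non-negative residues. -/
theorem isPos_intCast_iff {m0 m1 p : ℕ} (hp : 0 < p) (a B C : ℤ) :
    IsPos m0 m1 p (a, (B : ZMod p), (C : ZMod p)) ↔ B % p ≤ a * m0 ∧ C % p ≤ a * m1 := by
  have hp' : (p : ℤ) ≠ 0 := by exact_mod_cast hp.ne'
  have emod_le : ∀ (b : ℕ) (D : ℤ), (b : ZMod p) = D → D % p ≤ b := by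
    intro b D h
    have h' : ((b : ℤ) : ZMod p) = (D : ZMod p) := by exact_mod_cast h
    rw [← ((ZMod.intCast_eq_intCast_iff' _ _ _).1 h')]
    exact Int.emod_le_self_of_nonneg (Int.natCast_nonneg b) p
  have exists_rep : ∀ D : ℤ, ∃ b : ℕ, (b : ZMod p) = D ∧ (b : ℤ) = D % p := by
    intro D
    have h := Int.toNat_of_nonneg (Int.emod_nonneg D hp')
    refine ⟨(D % p).toNat, ?_, h⟩
    rw [← Int.cast_natCast, h, ZMod.intCast_mod]
  constructor
  · rintro ⟨b, c, hb, hc, hba, hca⟩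
    exact ⟨(emod_le b B hb).trans hba, (emod_le c C hc).trans hca⟩
  · rintro ⟨hB, hC⟩
    obtain ⟨b, hb, hb'⟩ := exists_rep B
    obtain ⟨c, hc, hc'⟩ := exists_rep C
    exact ⟨b, c, hb, hc, hb'.trans_le hB, hc'.trans_le hC⟩

/-- Scaling a triple by a positive integer dividing the modulus scales the residues. -/
theorem isPos_mul_iff {m0 m1 m q : ℕ} (hm : 0 < m) (hq : 0 < q) (a B C : ℤ) :
    IsPos m0 m1 (q * m) (a * q, ((q * B : ℤ) : ZMod (q * m)), ((q * C : ℤ) : ZMod (q * m))) ↔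
      B % m ≤ a * m0 ∧ C % m ≤ a * m1 := by
  have hq' : (0 : ℤ) < q := by exact_mod_cast hq
  have scale : ∀ (D : ℤ) (k : ℕ),
      (q * D : ℤ) % ((q * m : ℕ) : ℤ) ≤ a * q * k ↔ D % m ≤ a * k := by
    intro D k
    rw [Nat.cast_mul, Int.mul_emod_mul_of_pos _ _ hq', mul_right_comm, mul_comm _ (q : ℤ)]
    exact mul_le_mul_iff_right₀ hq'
  rw [isPos_intCast_iff (Nat.mul_pos hq hm), scale, scale]

/-- If the residue of `A` is at most `y`, then so is that of `y - A`. -/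
theorem Int.sub_emod_le_of_emod_le {m : ℕ} {y A : ℤ} (hm : 0 < m) (h : A % m ≤ y) :
    (y - A) % m ≤ y := by
  have h1 : (y - A) % m = (y - A % m) % m := by rw [Int.sub_emod_emod]
  have h2 := Int.emod_le_self_of_nonneg (sub_nonneg.2 h) m
  have h3 := Int.emod_nonneg A (Int.natCast_ne_zero.2 hm.ne')
  omega

/-- (Proposition 5.8) Let `m0, m1 ≥ 2`, `gcd(m0,m1)=1`, `m0·m1 ∣ m`,
`m ∣ p`, `β0 ≥ 0 ≥ β1`, `β0·m0 + β1·m1 = 1`, and let `Φ` be the map induced on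
`K0(·; ℤ ⊕ ℤ/p)` by the KK-element `β0·x·δ0 + β1·x·δ1`.  With `R`, `S` the remainders
of `β0·m0·m0·x`, `β0·m0·m1·x` upon division by `m`, `Φ` sends the four generators
`[δ0]`, `[δ1]`, `[id]`, `[id‾]` of the Dadarlat–Loring positive cone to positive
triples if and only if `x = 0`, or `β0·m0·m0·x ≥ m`, `β0·m0·m1·x ≥ m`, `m0·x ≥ R` and
`m1·x ≥ S`. -/
theorem stmt_13 (m0 m1 m p : ℕ) (hm0 : 2 ≤ m0) (hm1 : 2 ≤ m1) (hm : 0 < m) (hp : 0 < p)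
    (hcop : Nat.gcd m0 m1 = 1) (hdm : m0 * m1 ∣ m) (hmp : m ∣ p)
    (β0 β1 : ℤ) (hβ0 : 0 ≤ β0) (hβ1 : β1 ≤ 0) (hβ : β0 * m0 + β1 * m1 = 1)
    (x : ℤ)
    (Φ : ℤ × ZMod p × ZMod p → ℤ × ZMod p × ZMod p)
    (hΦ : ∀ t : ℤ × ZMod p × ZMod p,
      Φ t = (x * t.1,
        ((x * m0 : ℤ) : ZMod p) * ((β0 : ZMod p) * t.2.1 + (β1 : ZMod p) * t.2.2),
        ((x * m1 : ℤ) : ZMod p) * ((β0 : ZMod p) * t.2.1 + (β1 : ZMod p) * t.2.2)))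
    (R S : ℤ) (hR : R = β0 * m0 * m0 * x % (m : ℤ)) (hS : S = β0 * m0 * m1 * x % (m : ℤ)) :
    (IsPos m0 m1 p (Φ (1, 0, 0)) ∧
     IsPos m0 m1 p (Φ (1, (m0 : ZMod p), (m1 : ZMod p))) ∧
     IsPos m0 m1 p (Φ (((p / m : ℕ) : ℤ), 0, ((p / m * m1 : ℕ) : ZMod p))) ∧
     IsPos m0 m1 p (Φ (((p / m : ℕ) : ℤ), ((p / m * m0 : ℕ) : ZMod p), 0))) ↔
    (x = 0 ∨
      ((m : ℤ) ≤ β0 * m0 * m0 * x ∧ (m : ℤ) ≤ β0 * m0 * m1 * x ∧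
        R ≤ m0 * x ∧ S ≤ m1 * x)) := by
  have hm' : (0 : ℤ) < m := by exact_mod_cast hm
  have hm0' : (2 : ℤ) ≤ m0 := by exact_mod_cast hm0
  have hm1' : (2 : ℤ) ≤ m1 := by exact_mod_cast hm1
  obtain ⟨q, rfl⟩ := exists_eq_mul_left_of_dvd hmp
  have hq : 0 < q := Nat.pos_of_mul_pos_right hp
  have image_zero : Φ (1, 0, 0) = (x, ((0 : ℤ) : ZMod (q * m)), ((0 : ℤ) : ZMod (q * m))) := by
    simp [hΦ]
  have hβ' : (β0 : ZMod (q * m)) * m0 + β1 * m1 = 1 := by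
    exact_mod_cast congrArg (Int.cast : ℤ → ZMod (q * m)) hβ
  have image_one : Φ (1, (m0 : ZMod (q * m)), (m1 : ZMod (q * m))) =
      (x, ((x * m0 : ℤ) : ZMod (q * m)), ((x * m1 : ℤ) : ZMod (q * m))) := by
    simp [hΦ, hβ']
  have image_id : Φ ((q : ℤ), 0, ((q * m1 : ℕ) : ZMod (q * m))) =
      (x * q, ((q * (m0 * x - β0 * m0 * m0 * x) : ℤ) : ZMod (q * m)),
        ((q * (m1 * x - β0 * m0 * m1 * x) : ℤ) : ZMod (q * m))) := by
    rw [hΦ]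
    push_cast
    refine Prod.ext rfl (Prod.ext ?_ ?_)
    · linear_combination (q * m0 * x : ZMod (q * m)) * hβ'
    · linear_combination (q * m1 * x : ZMod (q * m)) * hβ'
  have image_id_bar : Φ ((q : ℤ), ((q * m0 : ℕ) : ZMod (q * m)), 0) =
      (x * q, ((q * (β0 * m0 * m0 * x) : ℤ) : ZMod (q * m)),
        ((q * (β0 * m0 * m1 * x) : ℤ) : ZMod (q * m))) := by
    rw [hΦ]
    push_cast
    refine Prod.ext rfl (Prod.ext ?_ ?_) <;> ring
  rw [Nat.mul_div_cancel q hm, image_zero, image_one, image_id, image_id_bar,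
    isPos_intCast_iff hp, isPos_intCast_iff hp, isPos_mul_iff hm hq, isPos_mul_iff hm hq,
    ← hR, ← hS, mul_comm x (m0 : ℤ), mul_comm x (m1 : ℤ), Int.zero_emod]
  constructor
  · rintro ⟨⟨hx, -⟩, -, -, hRx, hSx⟩
    refine or_iff_not_imp_left.2 fun hx0 => ?_
    have hxpos : 0 < x := (nonneg_of_mul_nonneg_right hx (by omega)).lt_of_ne' hx0
    have hβm : 1 < β0 * m0 := by
      have : β1 ≠ 0 := by
        rintro rfl
        rw [zero_mul, add_zero] at hβ
        have := Int.le_of_dvd one_pos (Dvd.intro_left β0 hβ)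
        omega
      have : β1 ≤ -1 := by omega
      nlinarith
    have le_of_emod_le : ∀ k : ℤ, 2 ≤ k →
        β0 * m0 * k * x % (m : ℤ) ≤ k * x → (m : ℤ) ≤ β0 * m0 * k * x := by
      intro k hk h
      have hkx : 0 < k * x := mul_pos (by omega) hxpos
      have hlt : k * x < β0 * m0 * k * x := by nlinarith
      by_contra! hlt'
      rw [Int.emod_eq_of_lt (by omega) hlt'] at h
      omega
    exact ⟨le_of_emod_le m0 hm0' (hR ▸ hRx), le_of_emod_le m1 hm1' (hS ▸ hSx), hRx, hSx⟩
  · intro h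
    have hRS : R ≤ m0 * x ∧ S ≤ m1 * x := by
      rcases h with rfl | h
      · simp [hR, hS]
      · exact h.2.2
    have hx0 : 0 ≤ (m0 : ℤ) * x := (hR ▸ Int.emod_nonneg _ hm'.ne').trans hRS.1
    have hx1 : 0 ≤ (m1 : ℤ) * x := (hS ▸ Int.emod_nonneg _ hm'.ne').trans hRS.2
    exact ⟨⟨hx0, hx1⟩, ⟨Int.emod_le_self_of_nonneg hx0 _, Int.emod_le_self_of_nonneg hx1 _⟩,
      ⟨Int.sub_emod_le_of_emod_le hm (hR ▸ hRS.1), Int.sub_emod_le_of_emod_le hm (hS ▸ hRS.2)⟩,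
      hRS⟩
end
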